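/- Let (X,d) be an (R,D)-thin metric space. If X contains two divergent rays, i.e. rays r₁, r₂ : [0,∞) → X with limsup_{t→∞} d(r₁(t), r₂(t)) = +∞, then X contains a line, i.e. there exists an isometric map ℝ → X. -/

import Mathlib

open Metric Set

/-- `l` restricted to `[a, b]` is a unit-speed segment (isometric embedding of `[a,b]`). -/
def IsSegmentOn {X : Type*} [PseudoMetricSpace X] (l : ℝ → X) (a b : ℝ) : Prop :=
  ∀ s ∈ Set.Icc a b, ∀ t ∈ Set.Icc a b, dist (l s) (l t) = |s - t|

/-- A ray in `X`: an isometric embedding of `[0, ∞)`. -/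
def IsRay {X : Type*} [PseudoMetricSpace X] (r : ℝ → X) : Prop :=
  ∀ s t : ℝ, 0 ≤ s → 0 ≤ t → dist (r s) (r t) = |s - t|

/-- `X` is a geodesic space: any two points are joined by a segment. -/
def IsGeodesicSpace (X : Type*) [PseudoMetricSpace X] : Prop :=
  ∀ x y : X, ∃ f : ℝ → X, IsSegmentOn f 0 (dist x y) ∧ f 0 = x ∧ f (dist x y) = y

/-- The metric projection of a point `x` to a set `K`:
the set of points of `K` realizing the distance from `x` to `K`. -/
def metricProj {X : Type*} [PseudoMetricSpace X] (K : Set X) (x : X) : Set X :=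
  {y ∈ K | dist x y = Metric.infDist x K}

/-- The metric projection of a set `A` to a set `K`. -/
def metricProjSet {X : Type*} [PseudoMetricSpace X] (K A : Set X) : Set X :=
  ⋃ x ∈ A, metricProj K x

/-- `S` contains a `c`-net of `T`: every point of `T` is within distance `c` of `S`. -/
def ContainsNetOf {X : Type*} [PseudoMetricSpace X] (S T : Set X) (c : ℝ) : Prop :=
  ∀ p ∈ T, ∃ q ∈ S, dist p q ≤ c

/-- An `(R,D)`-thin metric space: a proper, separable, geodesic metric space
(with `R ≥ 20 D > 0`) such that for every segment `l` of length `L > 2R`, every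
`t ∈ (R, L - R)` and every `x` whose projection to `l` meets `l(t)`, one has
`dist(x, l) < D`. -/
structure IsThinSpace (X : Type*) [MetricSpace X] (R D : ℝ) : Prop where
  R_pos : 0 < R
  D_pos : 0 < D
  twentyD_le_R : 20 * D ≤ R
  proper : ProperSpace X
  separable : TopologicalSpace.SeparableSpace X
  geodesic : IsGeodesicSpace X
  thin : ∀ (l : ℝ → X) (L : ℝ), 2 * R < L → IsSegmentOn l 0 L →
    ∀ t ∈ Set.Ioo R (L - R), ∀ x : X,
      dist x (l t) = Metric.infDist x (l '' Set.Icc 0 L) →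
      Metric.infDist x (l '' Set.Icc 0 L) < D

theorem IsSegmentOn.continuousOn {X : Type*} [PseudoMetricSpace X] {l : ℝ → X} {a b : ℝ}
    (hl : IsSegmentOn l a b) : ContinuousOn l (Icc a b) := by
  have h : LipschitzOnWith 1 l (Icc a b) := LipschitzOnWith.of_dist_le_mul fun s hs t ht => by
    simp [hl s hs t ht, Real.dist_eq]
  exact h.continuousOn

theorem IsRay.isSegmentOn {X : Type*} [PseudoMetricSpace X] {r : ℝ → X} (hr : IsRay r) (L : ℝ) :
    IsSegmentOn r 0 L :=
  fun s hs t ht => hr s t hs.1 ht.1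

/-- A proper space containing arbitrarily long segments whose midpoints stay bounded contains a
line. -/
theorem exists_line_of_segments {X : Type*} [MetricSpace X] [ProperSpace X] (p : X) (K : ℝ)
    (h : ∀ n : ℕ, ∃ g : ℝ → X, IsSegmentOn g (-n) n ∧ dist (g 0) p ≤ K) :
    ∃ f : ℝ → X, ∀ s t : ℝ, dist (f s) (f t) = |s - t| := by
  choose g hg hgp using h
  let U := Filter.hyperfilter ℕ
  have hU : (U : Filter ℕ) ≤ Filter.atTop := Nat.hyperfilter_le_atTop
  have hmem (t : ℝ) : ∀ᶠ n : ℕ in (U : Filter ℕ), t ∈ Icc (-(n : ℝ)) n := by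
    refine hU ?_
    filter_upwards [Filter.eventually_ge_atTop ⌈|t|⌉₊] with n hn
    exact abs_le.1 (Nat.ceil_le.1 hn)
  have hlim (t : ℝ) : ∃ y, Filter.Tendsto (fun n => g n t) U (nhds y) := by
    have hball : ∀ᶠ n in (U : Filter ℕ), g n t ∈ closedBall p (|t| + K) := by
      filter_upwards [hmem t, hmem 0] with n ht h0
      have h1 := hg n t ht 0 h0
      rw [sub_zero] at h1
      exact (dist_triangle _ (g n 0) _).trans (by linarith [hgp n])
    obtain ⟨y, -, hy⟩ := (isCompact_closedBall p (|t| + K)).ultrafilter_le_nhds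
      (U.map fun n => g n t) (Filter.le_principal_iff.2 hball)
    exact ⟨y, hy⟩
  choose f hf using hlim
  refine ⟨f, fun s t => tendsto_nhds_unique ((hf s).dist (hf t)) ?_⟩
  refine tendsto_const_nhds.congr' ?_
  filter_upwards [hmem s, hmem t] with n hs ht
  exact (hg n s hs t ht).symm

/-- In a thin space, a segment from a point of a ray to a point far away from the ray passes
close to the origin of the ray. -/
theorem IsThinSpace.exists_dist_le_of_segment {X : Type*} [MetricSpace X] {R D : ℝ}
    (hX : IsThinSpace X R D) {r : ℝ → X} (hr : IsRay r) {l : ℝ → X} {L s : ℝ} (hL : 0 ≤ L)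
    (hs : 0 ≤ s) (hl : IsSegmentOn l 0 L) (h0 : l 0 = r s)
    (hfar : ∀ u, 0 ≤ u → D ≤ dist (l L) (r u)) :
    ∃ v ∈ Icc 0 L, dist (l v) (r 0) ≤ D + R := by
  have hR := hX.R_pos
  have hD := hX.D_pos
  set N := L + s + D + 2 * R + 1 with hN
  have hNs : IsSegmentOn r 0 N := hr.isSegmentOn N
  have hne : (r '' Icc 0 N).Nonempty := ⟨r 0, mem_image_of_mem r ⟨le_rfl, by linarith⟩⟩
  have hzero : infDist (l 0) (r '' Icc 0 N) = 0 := by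
    rw [h0]
    exact infDist_zero_of_mem (mem_image_of_mem r ⟨hs, by linarith⟩)
  have hend : D ≤ infDist (l L) (r '' Icc 0 N) := by
    rw [le_infDist hne]
    rintro _ ⟨u, hu, rfl⟩
    exact hfar u hu.1
  obtain ⟨v, hv, hvD⟩ := intermediate_value_Icc hL
    ((continuous_infDist_pt (r '' Icc 0 N)).comp_continuousOn hl.continuousOn)
    (show D ∈ Icc _ _ from ⟨by simpa only [Function.comp_apply, hzero] using hD.le, hend⟩)
  simp only [Function.comp_apply] at hvD
  refine ⟨v, hv, ?_⟩
  obtain ⟨_, ⟨u, hu, rfl⟩, hud⟩ :=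
    (isCompact_Icc.image_of_continuousOn hNs.continuousOn).exists_infDist_eq_dist hne (l v)
  have huR : u ≤ R := by
    by_contra! hRu
    have h1 : dist (r u) (r s) ≤ D + L := by
      have h2 := hl v hv 0 ⟨le_rfl, hL⟩
      rw [h0, sub_zero, abs_of_nonneg hv.1] at h2
      have h3 := dist_triangle_left (r u) (r s) (l v)
      linarith [hv.2]
    rw [hr u s hu.1 hs] at h1
    have h4 := le_abs_self (u - s)
    have := hX.thin r N (by linarith) hNs u ⟨hRu, by linarith⟩ (l v) hud.symm
    linarith
  have h5 := hr u 0 hu.1 le_rfl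
  rw [sub_zero, abs_of_nonneg hu.1] at h5
  linarith [dist_triangle (l v) (r u) (r 0)]

theorem IsRay.le_dist_of_le_dist {X : Type*} [PseudoMetricSpace X] {r₁ r₂ : ℝ → X}
    (hr₁ : IsRay r₁) (hr₂ : IsRay r₂) {D t u : ℝ} (ht : 0 ≤ t) (hu : 0 ≤ u)
    (h : 2 * D + dist (r₁ 0) (r₂ 0) ≤ dist (r₁ t) (r₂ t)) : D ≤ dist (r₂ t) (r₁ u) := by
  have h1 := hr₁ t u ht hu
  have h2 := hr₁ u 0 hu le_rfl
  have h3 := hr₂ t 0 ht le_rfl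
  rw [sub_zero, abs_of_nonneg ‹_›] at h2 h3
  have h4 := dist_triangle_right (r₁ t) (r₂ t) (r₁ u)
  have h5 := dist_triangle4 (r₂ t) (r₁ u) (r₁ 0) (r₂ 0)
  have h6 := dist_triangle4 (r₁ u) (r₂ t) (r₂ 0) (r₁ 0)
  rw [dist_comm (r₁ u) (r₂ t), dist_comm (r₂ 0) (r₁ 0)] at h6
  have h7 : |t - u| ≤ dist (r₂ t) (r₁ u) + dist (r₁ 0) (r₂ 0) :=
    abs_le.2 ⟨by linarith, by linarith⟩
  linarith

/-- Lemma 4.9: an `(R,D)`-thin metric space containing two divergent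
rays contains a line. -/
theorem thin_divergent_rays_implies_line
    {X : Type*} [MetricSpace X] {R D : ℝ} (hX : IsThinSpace X R D)
    {r₁ r₂ : ℝ → X} (hr₁ : IsRay r₁) (hr₂ : IsRay r₂)
    (hdiv : ∀ M T : ℝ, ∃ t, T ≤ t ∧ M ≤ dist (r₁ t) (r₂ t)) :
    ∃ f : ℝ → X, ∀ s t : ℝ, dist (f s) (f t) = |s - t| := by
  have := hX.proper
  have hR := hX.R_pos
  have hD := hX.D_pos
  set C := dist (r₁ 0) (r₂ 0)
  have hC0 : 0 ≤ C := dist_nonneg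
  refine exists_line_of_segments (r₁ 0) (D + R) fun n => ?_
  have hn : (0 : ℝ) ≤ n := n.cast_nonneg
  set s : ℝ := n + C + D + R with hs_def
  have hs : 0 ≤ s := by linarith
  obtain ⟨t, hst, ht⟩ := hdiv (2 * D + C) s
  have ht0 : 0 ≤ t := hs.trans hst
  obtain ⟨l, hl, hl0, hl1⟩ := hX.geodesic (r₁ s) (r₂ t)
  obtain ⟨v, hv, hvd⟩ := hX.exists_dist_le_of_segment hr₁ dist_nonneg hs hl hl0
    fun u hu => by rw [hl1]; exact hr₁.le_dist_of_le_dist hr₂ ht0 hu ht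
  have hleft : (n : ℝ) ≤ v := by
    have h1 := hl v hv 0 ⟨le_rfl, dist_nonneg⟩
    have h2 := hr₁ s 0 hs le_rfl
    rw [hl0, sub_zero, abs_of_nonneg hv.1] at h1
    rw [sub_zero, abs_of_nonneg hs] at h2
    linarith [dist_triangle_left (r₁ s) (r₁ 0) (l v)]
  have hright : v + n ≤ dist (r₁ s) (r₂ t) := by
    have h1 := hl _ ⟨dist_nonneg, le_rfl⟩ v hv
    have h2 := hr₂ t 0 ht0 le_rfl
    rw [hl1, abs_of_nonneg (sub_nonneg.2 hv.2)] at h1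
    rw [sub_zero, abs_of_nonneg ht0] at h2
    linarith [dist_triangle4 (r₂ t) (l v) (r₁ 0) (r₂ 0)]
  refine ⟨fun τ => l (v + τ), fun a ha b hb => ?_, by simpa using hvd⟩
  rw [hl _ ⟨by linarith [ha.1], by linarith [ha.2]⟩ _ ⟨by linarith [hb.1], by linarith [hb.2]⟩,
    add_sub_add_left_eq_sub]
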